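/- arXiv:2302.01517 — 7 statements merged into one kernel-verified Lean document; each statement's English description precedes it below -/
import Mathlib

section
/- Let f : ℝ^N → ℝ be a pseudonorm, i.e. f is nonnegative, f(0) = 0, f(αz) = α·f(z) for all α ≥ 0 and z, and f(z + z') ≤ f(z) + f(z') for all z, z'. Let T*_f = {θ ∈ ℝ^N : ∀ z ∈ ℝ^N, ⟨θ, z⟩ ≤ f(z)} be its dual set. Then for every nonempty closed bounded convex set S ⊆ ℝ^N and every z ∈ ℝ^N, the pseudodistance from z to S satisfies inf_{s ∈ S} f(z − s) = sup_{θ ∈ T*_f} ( ⟨θ, z⟩ − sup_{s ∈ S} ⟨θ, s⟩ ). -/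
/-- **Mazur–Orlicz theorem** for a convex set: if a sublinear functional `p` is at least `d` on a
nonempty convex set `C`, then `p` dominates a linear functional which is at least `d` on `C`. -/
theorem exists_linearMap_le_sublinear_and_le_on_convex {E : Type*} [AddCommGroup E] [Module ℝ E]
    {p : E → ℝ} (p_zero : p 0 = 0) (p_hom : ∀ c : ℝ, 0 ≤ c → ∀ x, p (c • x) = c * p x)
    (p_add : ∀ x y, p (x + y) ≤ p x + p y) {C : Set E} (hC : Convex ℝ C) (hne : C.Nonempty)
    {d : ℝ} (hd : ∀ c ∈ C, d ≤ p c) :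
    ∃ g : E →ₗ[ℝ] ℝ, (∀ x, g x ≤ p x) ∧ ∀ c ∈ C, d ≤ g c := by
  obtain ⟨c₀, hc₀⟩ := hne
  let A : E → Set ℝ := fun x => {r | ∃ t : ℝ, 0 ≤ t ∧ ∃ c ∈ C, r = p (x + t • c) - t * d}
  have bdd (x : E) : BddBelow (A x) := by
    refine ⟨-p (-x), ?_⟩
    rintro _ ⟨t, ht, c, hc, rfl⟩
    have h₁ := p_add (x + t • c) (-x)
    rw [add_neg_cancel_comm, p_hom t ht] at h₁
    linarith [mul_le_mul_of_nonneg_left (hd c hc) ht]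
  have ne (x : E) : (A x).Nonempty := ⟨_, 0, le_rfl, c₀, hc₀, rfl⟩
  have hom_le (a : ℝ) (ha : 0 < a) (x : E) : sInf (A (a • x)) ≤ a * sInf (A x) := by
    rw [← div_le_iff₀' ha]
    refine le_csInf (ne x) ?_
    rintro _ ⟨t, ht, c, hc, rfl⟩
    rw [div_le_iff₀' ha]
    refine csInf_le (bdd _) ⟨a * t, by positivity, c, hc, ?_⟩
    rw [mul_smul, ← smul_add, p_hom a ha.le]
    ring
  have hom (a : ℝ) (ha : 0 < a) (x : E) : sInf (A (a • x)) = a * sInf (A x) := by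
    refine le_antisymm (hom_le a ha x) ?_
    have h := hom_le a⁻¹ (inv_pos.2 ha) (a • x)
    rwa [inv_smul_smul₀ ha.ne', le_inv_mul_iff₀ ha] at h
  have add (x y : E) : sInf (A (x + y)) ≤ sInf (A x) + sInf (A y) := by
    rw [← sub_le_iff_le_add]
    refine le_csInf (ne x) ?_
    rintro _ ⟨t, ht, c, hc, rfl⟩
    rw [sub_le_comm]
    refine le_csInf (ne y) ?_
    rintro _ ⟨u, hu, e, he, rfl⟩
    obtain ⟨b, hb, hbc⟩ := hC.exists_mem_add_smul_eq hc he ht hu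
    have h₁ : sInf (A (x + y)) ≤ p (x + y + (t + u) • b) - (t + u) * d :=
      csInf_le (bdd _) ⟨t + u, add_nonneg ht hu, b, hb, rfl⟩
    rw [hbc, add_add_add_comm] at h₁
    linarith [p_add (x + t • c) (y + u • e)]
  obtain ⟨g, -, hg⟩ := exists_extension_of_le_sublinear (⊥ : E →ₗ.[ℝ] ℝ)
    (fun x => sInf (A x)) hom add (by
      rintro ⟨x, hx⟩
      obtain rfl : x = 0 := (Submodule.mem_bot ℝ).1 hx
      have h0 := hom 2 two_pos 0
      rw [smul_zero] at h0
      have h1 : (⊥ : E →ₗ.[ℝ] ℝ) ⟨0, hx⟩ = 0 := LinearPMap.map_zero _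
      rw [h1]
      linarith)
  refine ⟨g, fun x => (hg x).trans (csInf_le (bdd x) ⟨0, le_rfl, c₀, hc₀, by simp⟩),
    fun c hc => ?_⟩
  have h := (hg (-c)).trans (csInf_le (bdd (-c)) ⟨1, zero_le_one, c, hc, rfl⟩)
  simp only [one_smul, neg_add_cancel, p_zero, map_neg, one_mul, zero_sub] at h
  linarith


/-- **Pseudonorm duality (Theorem: general function).**
For a pseudonorm `f` on `ℝ^N` with dual set `T*_f = {θ | ∀ z, ⟨θ,z⟩ ≤ f z}`, and any
nonempty closed bounded convex set `S`, the pseudodistance `inf_{s ∈ S} f (z - s)` equals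
`sup_{θ ∈ T*_f} (⟨θ, z⟩ - sup_{s ∈ S} ⟨θ, s⟩)`. -/
theorem pseudonorm_distance_duality (N : ℕ) (f : (Fin N → ℝ) → ℝ)
    (hf_nonneg : ∀ z, 0 ≤ f z) (hf_zero : f 0 = 0)
    (hf_homog : ∀ (α : ℝ), 0 ≤ α → ∀ z, f (α • z) = α * f z)
    (hf_tri : ∀ z z', f (z + z') ≤ f z + f z')
    (S : Set (Fin N → ℝ)) (hS_ne : S.Nonempty) (hS_closed : IsClosed S)
    (hS_bdd : Bornology.IsBounded S) (hS_conv : Convex ℝ S)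
    (z : Fin N → ℝ) :
    sInf ((fun s => f (z - s)) '' S)
      = sSup ((fun θ => (∑ i, θ i * z i) - sSup ((fun s => ∑ i, θ i * s i) '' S)) ''
          {θ : Fin N → ℝ | ∀ x, (∑ i, θ i * x i) ≤ f x}) := by
  have hbdd : BddBelow ((fun s => f (z - s)) '' S) :=
    ⟨0, by rintro _ ⟨s, -, rfl⟩; exact hf_nonneg _⟩
  have hS_compact : IsCompact S := Metric.isCompact_of_isClosed_isBounded hS_closed hS_bdd
  have le_inf : ∀ r ∈ (fun θ => (∑ i, θ i * z i) - sSup ((fun s => ∑ i, θ i * s i) '' S)) ''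
      {θ : Fin N → ℝ | ∀ x, (∑ i, θ i * x i) ≤ f x}, r ≤ sInf ((fun s => f (z - s)) '' S) := by
    rintro _ ⟨θ, hθ, rfl⟩
    refine le_csInf (hS_ne.image _) ?_
    rintro _ ⟨s, hs, rfl⟩
    have hθ_bdd : BddAbove ((fun s => ∑ i, θ i * s i) '' S) :=
      hS_compact.bddAbove_image (by fun_prop)
    have h₁ := le_csSup hθ_bdd ⟨s, hs, rfl⟩
    have h₂ := hθ (z - s)
    simp only [Pi.sub_apply, mul_sub, Finset.sum_sub_distrib] at h₁ h₂ ⊢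
    linarith
  obtain ⟨g, hgf, hgS⟩ := exists_linearMap_le_sublinear_and_le_on_convex hf_zero hf_homog hf_tri
    (C := (fun s => z - s) '' S) (d := sInf ((fun s => f (z - s)) '' S))
    (by
      rintro _ ⟨s, hs, rfl⟩ _ ⟨t, ht, rfl⟩ a b ha hb hab
      refine ⟨a • s + b • t, hS_conv hs ht ha hb hab, ?_⟩
      simp only [smul_sub, sub_add_sub_comm, ← add_smul, hab, one_smul])
    (hS_ne.image _)
    (by rintro _ ⟨s, hs, rfl⟩; exact csInf_le hbdd ⟨s, hs, rfl⟩)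
  let θ : Fin N → ℝ := fun i => g (Pi.single i 1)
  have hθ (x : Fin N → ℝ) : ∑ i, θ i * x i = g x := by
    conv_rhs => rw [pi_eq_sum_univ' x, map_sum]
    simp [θ, mul_comm]
  have hmem : θ ∈ {θ : Fin N → ℝ | ∀ x, (∑ i, θ i * x i) ≤ f x} := fun x => by
    rw [hθ]; exact hgf x
  refine le_antisymm (le_trans ?_ (le_csSup ⟨_, le_inf⟩ ⟨θ, hmem, rfl⟩))
    (csSup_le ⟨_, θ, hmem, rfl⟩ le_inf)
  rw [le_sub_comm]
  refine csSup_le (hS_ne.image _) ?_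
  rintro _ ⟨s, hs, rfl⟩
  have h := hgS _ ⟨s, hs, rfl⟩
  simp only [hθ, map_sub] at h ⊢
  linarith
end

section
/- Let u_1, …, u_T ∈ ℝ^d and θ_1, …, θ_T ∈ Δ̄_d (where Δ̄_d = {θ ∈ ℝ^d : θ_i ≥ 0 for all i and ∑_i θ_i ≤ 1}) satisfy ⟨θ_t, u_t⟩ ≤ 0 for every t ∈ [T]. Then T · d_∞( (1/T) ∑_{t=1}^T u_t , (−∞, 0]^d ) = max( max_{i ∈ [d]} ∑_{t=1}^T u_{t,i}, 0 ) ≤ sup_{θ* ∈ Δ̄_d} ∑_{t=1}^T ( ⟨θ*, u_t⟩ − ⟨θ_t, u_t⟩ ). In particular the ℓ∞-approachability regret of the sequence (u_t) is bounded by the online-linear-optimization regret of the sequence (θ_t) on the losses y_t = −u_t over the domain Δ̄_d. -/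
/-- The `ℓ∞`-distance from `x` to the nonpositive orthant is `max (max_i x_i) 0`. -/
lemma isLeast_sup'_abs_sub_nonpos {ι : Type*} [Fintype ι] (h : (Finset.univ : Finset ι).Nonempty)
    (x : ι → ℝ) :
    IsLeast ((fun s => Finset.univ.sup' h (fun i => |x i - s i|)) '' {s : ι → ℝ | ∀ i, s i ≤ 0})
      (max (Finset.univ.sup' h x) 0) := by
  have hle (i : ι) : x i ≤ Finset.univ.sup' h x := Finset.le_sup' x (Finset.mem_univ i)
  have lower (s : ι → ℝ) (hs : ∀ i, s i ≤ 0) :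
      max (Finset.univ.sup' h x) 0 ≤ Finset.univ.sup' h (fun i => |x i - s i|) := by
    have habs (i : ι) : |x i - s i| ≤ Finset.univ.sup' h (fun i => |x i - s i|) :=
      Finset.le_sup' (fun i => |x i - s i|) (Finset.mem_univ i)
    refine max_le (Finset.sup'_le _ _ fun i _ => ?_) ?_
    · linarith [hs i, habs i, le_abs_self (x i - s i)]
    · exact (abs_nonneg _).trans (habs h.choose)
  refine ⟨⟨fun i => min (x i) 0, fun i => min_le_right _ _, le_antisymm ?_
    (lower _ fun i => min_le_right _ _)⟩, ?_⟩
  · refine Finset.sup'_le _ _ fun i _ => ?_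
    rcases le_total (x i) 0 with hx | hx
    · simp [min_eq_left hx]
    · simpa [min_eq_right hx, abs_of_nonneg hx] using Or.inl (hle i)
  · rintro _ ⟨s, hs, rfl⟩
    exact lower s hs

/-- A linear form on the convex hull of the simplex with the origin is at most the `ℓ¹`-norm of
its coefficients. -/
lemma sum_mul_le_sum_abs_of_sum_le_one {ι : Type*} [Fintype ι] {θ : ι → ℝ} (hθ : ∀ i, 0 ≤ θ i)
    (hsum : ∑ i, θ i ≤ 1) (u : ι → ℝ) : ∑ i, θ i * u i ≤ ∑ i, |u i| := by
  refine Finset.sum_le_sum fun i _ => ?_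
  have hi : θ i ≤ 1 :=
    (Finset.single_le_sum (fun j _ => hθ j) (Finset.mem_univ i)).trans hsum
  calc θ i * u i ≤ θ i * |u i| := mul_le_mul_of_nonneg_left (le_abs_self _) (hθ i)
    _ ≤ |u i| := mul_le_of_le_one_left (abs_nonneg _) hi


/-- **ℓ∞-approachability regret is bounded by the OLO regret over `Δ̄_d`.**
If `θ_t ∈ Δ̄_d` (nonnegative entries summing to at most 1) and `⟨θ_t, u_t⟩ ≤ 0` for all `t`,
then `T · d_∞((1/T) ∑_t u_t, (−∞,0]^d) = max(max_i ∑_t u_{t,i}, 0)` and this is at most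
the OLO regret `sup_{θ* ∈ Δ̄_d} ∑_t (⟨θ*, u_t⟩ − ⟨θ_t, u_t⟩)`. -/
theorem linf_approachability_regret_le_olo_regret (d T : ℕ) (hd : 0 < d) (hT : 0 < T)
    (u : Fin T → Fin d → ℝ) (θ : Fin T → Fin d → ℝ)
    (hθ : ∀ t, (∀ i, 0 ≤ θ t i) ∧ (∑ i, θ t i) ≤ 1)
    (hsep : ∀ t, (∑ i, θ t i * u t i) ≤ 0) :
    (T : ℝ) * sInf ((fun s => Finset.univ.sup' ⟨⟨0, hd⟩, Finset.mem_univ _⟩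
          (fun i => |(1 / (T : ℝ)) * (∑ t, u t i) - s i|)) ''
          {s : Fin d → ℝ | ∀ i, s i ≤ 0})
      = max (Finset.univ.sup' ⟨⟨0, hd⟩, Finset.mem_univ _⟩ (fun i => ∑ t, u t i)) 0 ∧
    max (Finset.univ.sup' ⟨⟨0, hd⟩, Finset.mem_univ _⟩ (fun i => ∑ t, u t i)) 0
      ≤ sSup ((fun θstar => ∑ t, ((∑ i, θstar i * u t i) - ∑ i, θ t i * u t i)) ''
          {θstar : Fin d → ℝ | (∀ i, 0 ≤ θstar i) ∧ (∑ i, θstar i) ≤ 1}) := by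
  have hT' : (0 : ℝ) < T := Nat.cast_pos.mpr hT
  constructor
  · have hne : (Finset.univ : Finset (Fin d)).Nonempty := ⟨⟨0, hd⟩, Finset.mem_univ _⟩
    refine (congrArg ((T : ℝ) * ·)
      (isLeast_sup'_abs_sub_nonpos hne fun i => (1 / (T : ℝ)) * ∑ t, u t i).csInf_eq).trans ?_
    simp only [mul_max_of_nonneg _ _ hT'.le, mul_zero, Finset.mul₀_sup' hT'.le, ← mul_assoc,
      mul_one_div_cancel hT'.ne', one_mul]
  · have bdd : BddAbove ((fun θstar => ∑ t, ((∑ i, θstar i * u t i) - ∑ i, θ t i * u t i)) ''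
        {θstar : Fin d → ℝ | (∀ i, 0 ≤ θstar i) ∧ (∑ i, θstar i) ≤ 1}) := by
      refine ⟨∑ t, ((∑ i, |u t i|) - ∑ i, θ t i * u t i), ?_⟩
      rintro _ ⟨θstar, hstar, rfl⟩
      exact Finset.sum_le_sum fun t _ =>
        sub_le_sub_right (sum_mul_le_sum_abs_of_sum_le_one hstar.1 hstar.2 (u t)) _
    have bound (v : Fin d → ℝ) (hv : ∀ i, 0 ≤ v i) (hv1 : ∑ i, v i ≤ 1) :
        ∑ t, ∑ i, v i * u t i ≤
          sSup ((fun θstar => ∑ t, ((∑ i, θstar i * u t i) - ∑ i, θ t i * u t i)) ''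
            {θstar : Fin d → ℝ | (∀ i, 0 ≤ θstar i) ∧ (∑ i, θstar i) ≤ 1}) :=
      (Finset.sum_le_sum fun t _ => by linarith [hsep t]).trans
        (le_csSup bdd ⟨v, ⟨hv, hv1⟩, rfl⟩)
    refine max_le (Finset.sup'_le _ _ fun i _ => ?_) ?_
    · have hsingle : (0 : Fin d → ℝ) ≤ Pi.single i 1 := Pi.single_nonneg.mpr zero_le_one
      simpa [Pi.single_apply] using bound (Pi.single i 1) hsingle (by simp)
    · simpa using bound 0 (fun _ => le_rfl) (by simp)
end

section
/- There is an absolute constant C₀ > 0 with the following property. Let P ⊆ [−1,1]^n be a nonempty compact convex set, L ⊆ [−1,1]^m a nonempty convex set, and u : ℝ^n × ℝ^m → ℝ^d a bilinear map with u(p, ℓ) ∈ [−1,1]^d for all p ∈ P, ℓ ∈ L, such that for every ℓ ∈ L there exists p ∈ P with u_i(p, ℓ) ≤ 0 for all i ∈ [d] (separability of the nonpositive orthant). Then there exists a learning algorithm, i.e. a family of functions A_t : L^{t−1} → P for t = 1, …, T, such that for every loss sequence ℓ_1, …, ℓ_T ∈ L, setting p_t = A_t(ℓ_1, …, ℓ_{t−1}),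 one has max( max_{i ∈ [d]} ∑_{t=1}^T u_i(p_t, ℓ_t), 0 ) ≤ C₀ · √(T · (1 + log d)). -/
/-- Minimax for a bilinear form on a compact convex set and a convex set: if every `y ∈ L` has a
response `x ∈ P` with nonpositive value, then one `x ∈ P` works against all `y ∈ L`. -/
theorem exists_forall_nonpos_of_forall_exists_nonpos {E F : Type*}
    [AddCommGroup E] [Module ℝ E] [TopologicalSpace E] [IsTopologicalAddGroup E]
    [ContinuousSMul ℝ E] [T2Space E] [FiniteDimensional ℝ E]
    [AddCommGroup F] [Module ℝ F] [TopologicalSpace F] [IsTopologicalAddGroup F]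
    [ContinuousSMul ℝ F] [T2Space F] [FiniteDimensional ℝ F]
    {P : Set E} {L : Set F} (hP : P.Nonempty) (kP : IsCompact P) (cP : Convex ℝ P)
    (cL : Convex ℝ L) (f : E →ₗ[ℝ] F →ₗ[ℝ] ℝ) (hf : ∀ y ∈ L, ∃ x ∈ P, f x y ≤ 0) :
    ∃ x ∈ P, ∀ y ∈ L, f x y ≤ 0 := by
  have hcont : ∀ y, Continuous fun x => f x y := fun y =>
    (f.flip y).continuous_of_finiteDimensional
  have hfin : ∀ s : Finset L, (P ∩ ⋂ y ∈ s, {x | f x y ≤ 0}).Nonempty := by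
    intro s
    by_contra hs
    obtain ⟨y, hy, hpos⟩ := Sion.exists_lt_iInf_of_lt_iInf_of_finite (f := fun x y => f x y)
      (Y := L) (t := 0) hP kP
      (fun y _ => (hcont y).lowerSemicontinuous.lowerSemicontinuousOn _)
      (fun y _ => ((f.flip y).convexOn cP).quasiconvexOn) cL
      (fun x _ => (f x).continuous_of_finiteDimensional.upperSemicontinuous.upperSemicontinuousOn _)
      (fun x _ => ((f x).concaveOn cL).quasiconcaveOn) cP
      (s := Subtype.val '' (s : Set L)) (s.finite_toSet.image _) (by simp) (by
        intro x hx
        by_contra! hle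
        exact hs ⟨x, hx, by simpa using fun y hy hys => hle y ⟨⟨y, hy⟩, hys, rfl⟩⟩)
    obtain ⟨x, hx, hle⟩ := hf y hy
    exact (hpos x hx).not_ge hle
  obtain ⟨x, hx, hx'⟩ := kP.inter_iInter_nonempty (fun y : L => {x | f x y ≤ 0})
    (fun y => isClosed_le (hcont y) continuous_const) hfin
  exact ⟨x, hx, fun y hy => Set.mem_iInter.1 hx' ⟨y, hy⟩⟩

/-- The cumulative payoff vector after `k` rounds when the learner plays `g S` whenever the
current cumulative payoff vector is `S`. -/
def cumulativePayoff {E F ι : Type*} (u : E → F → ι → ℝ) (g : (ι → ℝ) → E) :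
    (k : ℕ) → (Fin k → F) → ι → ℝ
  | 0, _ => 0
  | k + 1, h =>
    cumulativePayoff u g k (fun s => h s.castSucc) +
      u (g (cumulativePayoff u g k fun s => h s.castSucc)) (h (Fin.last k))

theorem cumulativePayoff_eq_sum {E F ι : Type*} (u : E → F → ι → ℝ) (g : (ι → ℝ) → E)
    (k : ℕ) (ℓ : Fin k → F) (i : ι) :
    cumulativePayoff u g k ℓ i =
      ∑ t : Fin k, u (g (cumulativePayoff u g t.1 fun s => ℓ ⟨s.1, s.2.trans t.2⟩)) (ℓ t) i := by
  induction k with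
  | zero => rfl
  | succ k ih =>
    rw [cumulativePayoff, Pi.add_apply, ih, Fin.sum_univ_castSucc]
    rfl

/-- One step of the exponential potential: it grows by a factor at most `exp (η ^ 2 / 2)` when the
increment has nonpositive weighted sum. -/
theorem sum_exp_add_le {ι : Type*} [Fintype ι] (η : ℝ) (hη : 0 ≤ η) (S v : ι → ℝ)
    (hv : ∀ i, v i ∈ Set.Icc (-1 : ℝ) 1) (hw : ∑ i, Real.exp (η * S i) * v i ≤ 0) :
    ∑ i, Real.exp (η * (S i + v i)) ≤ (∑ i, Real.exp (η * S i)) * Real.exp (η ^ 2 / 2) :=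
  calc ∑ i, Real.exp (η * (S i + v i))
      ≤ ∑ i, Real.exp (η * S i) * (Real.cosh η + v i * Real.sinh η) := by
        gcongr with i
        rw [mul_add, Real.exp_add, mul_comm η (v i)]
        gcongr
        exact Real.exp_mul_le_cosh_add_mul_sinh (abs_le.2 (hv i)) η
    _ = (∑ i, Real.exp (η * S i)) * Real.cosh η +
          (∑ i, Real.exp (η * S i) * v i) * Real.sinh η := by
        simp only [Finset.sum_mul, ← Finset.sum_add_distrib]
        exact Finset.sum_congr rfl fun i _ => by ring
    _ ≤ (∑ i, Real.exp (η * S i)) * Real.cosh η := by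
        linarith [mul_nonpos_of_nonpos_of_nonneg hw (Real.sinh_nonneg_iff.2 hη)]
    _ ≤ _ := by
        gcongr
        exact Real.cosh_le_exp_half_sq η

theorem sum_exp_cumulativePayoff_le {E F ι : Type*} [Fintype ι] (u : E → F → ι → ℝ)
    (g : (ι → ℝ) → E) (η : ℝ) (hη : 0 ≤ η) (L : Set F)
    (hu : ∀ S, ∀ y ∈ L, ∀ i, u (g S) y i ∈ Set.Icc (-1 : ℝ) 1)
    (hg : ∀ S, ∀ y ∈ L, ∑ i, Real.exp (η * S i) * u (g S) y i ≤ 0)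
    (k : ℕ) (ℓ : Fin k → F) (hℓ : ∀ t, ℓ t ∈ L) :
    ∑ i, Real.exp (η * cumulativePayoff u g k ℓ i) ≤
      Fintype.card ι * Real.exp (k * (η ^ 2 / 2)) := by
  induction k with
  | zero => simp [cumulativePayoff]
  | succ k ih =>
    refine (sum_exp_add_le η hη _ _ (hu _ _ (hℓ _)) (hg _ _ (hℓ _))).trans ?_
    grw [ih (fun s => ℓ s.castSucc) fun t => hℓ _]
    rw [mul_assoc, ← Real.exp_add]
    push_cast
    exact le_of_eq (by ring_nf)


/-- **Existence of an `O(√(T log d))` ℓ∞-approachability / regret-minimization algorithm.**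
There is an absolute constant `C₀ > 0` such that for any compact convex action set
`P ⊆ [−1,1]^n`, convex loss set `L ⊆ [−1,1]^m`, and bilinear payoff
`u : ℝ^n × ℝ^m → ℝ^d` bounded in `[−1,1]^d` on `P × L` for which the nonpositive orthant
is separable, there is a learning algorithm `A` whose regret against every loss sequence
is at most `C₀ √(T (1 + log d))`. -/
theorem exists_linf_approachability_algorithm :
    ∃ C₀ : ℝ, 0 < C₀ ∧
      ∀ (n m d T : ℕ) (hd : 0 < d)
        (P : Set (Fin n → ℝ)) (L : Set (Fin m → ℝ))
        (u : (Fin n → ℝ) → (Fin m → ℝ) → Fin d → ℝ),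
        P.Nonempty → IsCompact P → Convex ℝ P →
        (∀ p ∈ P, ∀ j, p j ∈ Set.Icc (-1 : ℝ) 1) →
        L.Nonempty → Convex ℝ L →
        (∀ ℓ ∈ L, ∀ k, ℓ k ∈ Set.Icc (-1 : ℝ) 1) →
        (∀ ℓ, IsLinearMap ℝ (fun p => u p ℓ)) →
        (∀ p, IsLinearMap ℝ (u p)) →
        (∀ p ∈ P, ∀ ℓ ∈ L, ∀ i, u p ℓ i ∈ Set.Icc (-1 : ℝ) 1) →
        (∀ ℓ ∈ L, ∃ p ∈ P, ∀ i, u p ℓ i ≤ 0) →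
        ∃ A : (t : Fin T) → (Fin t.1 → (Fin m → ℝ)) → (Fin n → ℝ),
          (∀ t h, A t h ∈ P) ∧
          ∀ ℓ : Fin T → (Fin m → ℝ), (∀ t, ℓ t ∈ L) →
            max (Finset.univ.sup' ⟨⟨0, hd⟩, Finset.mem_univ _⟩
                (fun i => ∑ t, u (A t (fun s => ℓ ⟨s.1, s.2.trans t.2⟩)) (ℓ t) i)) 0
              ≤ C₀ * Real.sqrt ((T : ℝ) * (1 + Real.log d)) := by
  refine ⟨3 / 2, by norm_num, ?_⟩
  intro n m d T hd P L u hP kP cP _ _ cL _ hlin₁ hlin₂ hbdd hsep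
  have hlog : 0 ≤ Real.log d := Real.log_natCast_nonneg d
  set η : ℝ := Real.sqrt ((1 + Real.log d) / T) with hη
  have hg : ∀ S : Fin d → ℝ, ∃ p ∈ P, ∀ y ∈ L, ∑ i, Real.exp (η * S i) * u p y i ≤ 0 := by
    intro S
    let f : (Fin n → ℝ) →ₗ[ℝ] (Fin m → ℝ) →ₗ[ℝ] ℝ :=
      LinearMap.mk₂ ℝ (fun p y => ∑ i, Real.exp (η * S i) * u p y i)
        (fun p q y => by
          simp [(hlin₁ y).map_add p q, mul_add, Finset.sum_add_distrib])
        (fun c p y => by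
          simp [(hlin₁ y).map_smul c p, Finset.mul_sum, mul_left_comm])
        (fun p y z => by
          simp [(hlin₂ p).map_add y z, mul_add, Finset.sum_add_distrib])
        (fun c p y => by
          simp [(hlin₂ p).map_smul c y, Finset.mul_sum, mul_left_comm])
    refine exists_forall_nonpos_of_forall_exists_nonpos hP kP cP cL f fun y hy => ?_
    obtain ⟨p, hp, hle⟩ := hsep y hy
    refine ⟨p, hp, ?_⟩
    change ∑ i, Real.exp (η * S i) * u p y i ≤ 0
    exact Finset.sum_nonpos fun i _ =>
      mul_nonpos_of_nonneg_of_nonpos (Real.exp_pos _).le (hle i)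
  choose g hgP hg using hg
  refine ⟨fun t h => g (cumulativePayoff u g t.1 h), fun t h => hgP _, fun ℓ hℓ => ?_⟩
  refine max_le (Finset.sup'_le _ _ fun i _ => ?_) (by positivity)
  rw [← cumulativePayoff_eq_sum u g T ℓ i]
  rcases Nat.eq_zero_or_pos T with rfl | hT
  · simp [cumulativePayoff]
  have hT' : (0 : ℝ) < T := by exact_mod_cast hT
  have hd' : (0 : ℝ) < d := by exact_mod_cast hd
  have hη0 : 0 < η := Real.sqrt_pos.2 (by positivity)
  have hηsq : η ^ 2 * T = 1 + Real.log d := by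
    rw [hη, Real.sq_sqrt (by positivity), div_mul_cancel₀ _ hT'.ne']
  have hsqrt : Real.sqrt ((T : ℝ) * (1 + Real.log d)) = η * T := by
    rw [Real.sqrt_eq_iff_mul_self_eq (by positivity) (by positivity), ← hηsq]
    ring
  have hpot : Real.exp (η * cumulativePayoff u g T ℓ i) ≤
      Real.exp (Real.log d + T * (η ^ 2 / 2)) := by
    rw [Real.exp_add, Real.exp_log hd']
    refine (Finset.single_le_sum (f := fun i => Real.exp (η * cumulativePayoff u g T ℓ i))
      (fun _ _ => (Real.exp_pos _).le) (Finset.mem_univ i)).trans ?_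
    simpa using sum_exp_cumulativePayoff_le u g η hη0.le L
      (fun S y hy => hbdd _ (hgP S) y hy) hg T ℓ hℓ
  rw [Real.exp_le_exp] at hpot
  rw [hsqrt]
  refine le_of_mul_le_mul_left ?_ hη0
  linear_combination hpot - hηsq
end

section
/- Let v_1, …, v_d ∈ ℝ^N, define the pseudonorm f(x) = max( max_{i ∈ [d]} ⟨v_i, x⟩, 0 ) and the convex cone C = {x ∈ ℝ^N : ⟨v_i, x⟩ ≤ 0 for all i ∈ [d]}, and let V : ℝ^N → ℝ^d be the linear map with (Vz)_i = ⟨v_i, z⟩. Then for every z ∈ ℝ^N, the ℓ∞-distance from Vz to the nonpositive orthant equals the f-pseudodistance from z to C: d_∞( Vz, (−∞, 0]^d ) = inf_{c ∈ C} f(z − c). In particular, if z = (1/T) ∑_{t=1}^T ũ(p_t, ℓ_t) and u_i(p, ℓ) = ⟨v_i, ũ(p, ℓ)⟩, then d_∞( (1/T) ∑_t u(p_t, ℓ_t), (−∞,0]^d ) = d_f( (1/T) ∑_t ũ(p_t, ℓ_t), C ). -/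
/-- **Dimension reduction: ℓ∞-distance to the nonpositive orthant equals the
pseudodistance to the cone `C`.**
For `v_1, …, v_d ∈ ℝ^N`, `f x = max(max_i ⟨v_i, x⟩, 0)`,
`C = {x | ∀ i, ⟨v_i, x⟩ ≤ 0}`, and `(Vz)_i = ⟨v_i, z⟩`, for every `z`:
`d_∞(Vz, (−∞,0]^d) = max(max_i ⟨v_i, z⟩, 0) = inf_{c ∈ C} f (z − c)`. -/
theorem linf_distance_eq_pseudodistance_to_cone (N d : ℕ) (hd : 0 < d)
    (v : Fin d → Fin N → ℝ) (z : Fin N → ℝ) :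
    max (Finset.univ.sup' ⟨⟨0, hd⟩, Finset.mem_univ _⟩ (fun i => ∑ j, v i j * z j)) 0
      = sInf ((fun c =>
            max (Finset.univ.sup' ⟨⟨0, hd⟩, Finset.mem_univ _⟩
              (fun i => ∑ j, v i j * (z j - c j))) 0) ''
          {x : Fin N → ℝ | ∀ i, (∑ j, v i j * x j) ≤ 0}) := by
  symm
  apply IsLeast.csInf_eq
  constructor
  · exact ⟨0, by simp, by simp⟩
  · rintro _ ⟨c, hc, rfl⟩
    refine max_le_max (Finset.sup'_mono_fun fun i _ => ?_) le_rfl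
    have h := hc i
    simp only [mul_sub, Finset.sum_sub_distrib]
    linarith
end

section
/- Let v_1, …, v_d ∈ ℝ^N, let f(x) = max( max_{i ∈ [d]} ⟨v_i, x⟩, 0 ) with dual set T*_f = {θ : ∀ x, ⟨θ, x⟩ ≤ f(x)}, and let C = {x ∈ ℝ^N : ⟨v_i, x⟩ ≤ 0 for all i ∈ [d]}. Then for every z ∈ ℝ^N, inf_{c ∈ C} f(z − c) = sup_{θ ∈ T*_f} ⟨θ, z⟩. -/
/-- **Pseudodistance to the cone `C` as linear optimization over the dual set.**
For `v_1, …, v_d ∈ ℝ^N`, `f x = max(max_i ⟨v_i, x⟩, 0)` with dual set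
`T*_f = {θ | ∀ x, ⟨θ, x⟩ ≤ f x}`, and `C = {x | ∀ i, ⟨v_i, x⟩ ≤ 0}`, for every `z`:
`inf_{c ∈ C} f (z − c) = sup_{θ ∈ T*_f} ⟨θ, z⟩`. -/
theorem pseudodistance_to_cone_eq_sup_dual (N d : ℕ) (hd : 0 < d)
    (v : Fin d → Fin N → ℝ) (z : Fin N → ℝ) :
    sInf ((fun c =>
          max (Finset.univ.sup' ⟨⟨0, hd⟩, Finset.mem_univ _⟩
            (fun i => ∑ j, v i j * (z j - c j))) 0) ''
        {x : Fin N → ℝ | ∀ i, (∑ j, v i j * x j) ≤ 0})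
      = sSup ((fun θ => ∑ j, θ j * z j) ''
          {θ : Fin N → ℝ | ∀ x : Fin N → ℝ,
            (∑ j, θ j * x j) ≤
              max (Finset.univ.sup' ⟨⟨0, hd⟩, Finset.mem_univ _⟩
                (fun i => ∑ j, v i j * x j)) 0}) := by
  have hne : (Finset.univ : Finset (Fin d)).Nonempty := ⟨⟨0, hd⟩, Finset.mem_univ _⟩
  trans max (Finset.univ.sup' hne (fun i => ∑ j, v i j * z j)) 0
  · refine IsLeast.csInf_eq ⟨⟨0, by simp, by simp⟩, ?_⟩
    rintro _ ⟨c, hc, rfl⟩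
    refine max_le_max (Finset.sup'_mono_fun fun i _ => ?_) le_rfl
    have h := hc i
    simp only [mul_sub, Finset.sum_sub_distrib]
    linarith
  refine (IsGreatest.csSup_eq ⟨?_, ?_⟩).symm
  · obtain ⟨i, -, hi⟩ := Finset.exists_mem_eq_sup' hne (fun i => ∑ j, v i j * z j)
    rcases max_choice (Finset.univ.sup' hne (fun i => ∑ j, v i j * z j)) 0 with h | h
    · refine ⟨v i, fun x => ?_, by rw [h, hi]⟩
      exact le_max_of_le_left
        (Finset.le_sup' (fun i => ∑ j, v i j * x j) (Finset.mem_univ i))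
    · exact ⟨0, fun x => by simp, by rw [h]; simp⟩
  · rintro _ ⟨θ, hθ, rfl⟩
    exact hθ z
end

section
/- Let v_1, …, v_d ∈ ℝ^N, f(x) = max( max_{i ∈ [d]} ⟨v_i, x⟩, 0 ) with dual set T*_f = {θ : ∀ x, ⟨θ, x⟩ ≤ f(x)}, and C = {x ∈ ℝ^N : ⟨v_i, x⟩ ≤ 0 ∀ i}. Let ũ_1, …, ũ_T ∈ ℝ^N and θ̃_1, …, θ̃_T ∈ T*_f satisfy ⟨θ̃_t, ũ_t⟩ ≤ 0 for every t ∈ [T]. Then T · d_f( (1/T) ∑_{t=1}^T ũ_t, C ) ≤ sup_{θ̃ ∈ T*_f} ∑_{t=1}^T ( ⟨θ̃, ũ_t⟩ − ⟨θ̃_t, ũ_t⟩ ). That is, the pseudonorm-approachability regret is bounded by the OLO regret of the sequence (θ̃_t) on losses y_t = −ũ_t over the domain T*_f. -/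
/-- **Pseudonorm-approachability regret is bounded by the OLO regret over `T*_f`.**
For `f x = max(max_i ⟨v_i, x⟩, 0)` with dual set `T*_f`, cone `C = {x | ∀ i, ⟨v_i,x⟩ ≤ 0}`,
payoffs `ũ_t` and dual plays `θ̃_t ∈ T*_f` with `⟨θ̃_t, ũ_t⟩ ≤ 0`:
`T · d_f((1/T) ∑_t ũ_t, C) ≤ sup_{θ̃ ∈ T*_f} ∑_t (⟨θ̃, ũ_t⟩ − ⟨θ̃_t, ũ_t⟩)`. -/
theorem pseudonorm_approachability_regret_le_olo_regret (N d T : ℕ) (hd : 0 < d) (hT : 0 < T)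
    (v : Fin d → Fin N → ℝ)
    (ut : Fin T → Fin N → ℝ) (θt : Fin T → Fin N → ℝ)
    (hθ : ∀ t, ∀ x : Fin N → ℝ,
        (∑ j, θt t j * x j) ≤
          max (Finset.univ.sup' ⟨⟨0, hd⟩, Finset.mem_univ _⟩ (fun i => ∑ j, v i j * x j)) 0)
    (hsep : ∀ t, (∑ j, θt t j * ut t j) ≤ 0) :
    (T : ℝ) * sInf ((fun c =>
          max (Finset.univ.sup' ⟨⟨0, hd⟩, Finset.mem_univ _⟩
            (fun i => ∑ j, v i j * ((1 / (T : ℝ)) * (∑ t, ut t j) - c j))) 0) ''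
        {x : Fin N → ℝ | ∀ i, (∑ j, v i j * x j) ≤ 0})
      ≤ sSup ((fun θ => ∑ t, ((∑ j, θ j * ut t j) - ∑ j, θt t j * ut t j)) ''
          {θ : Fin N → ℝ | ∀ x : Fin N → ℝ,
            (∑ j, θ j * x j) ≤
              max (Finset.univ.sup' ⟨⟨0, hd⟩, Finset.mem_univ _⟩
                (fun i => ∑ j, v i j * x j)) 0}) := by
  have hT' : (0 : ℝ) < T := by exact_mod_cast hT
  have hswap : ∀ θ : Fin N → ℝ, ∑ t, ∑ j, θ j * ut t j = ∑ j, θ j * ∑ t, ut t j := fun θ => by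
    rw [Finset.sum_comm]
    simp only [Finset.mul_sum]
  have hregret : ∀ θ : Fin N → ℝ,
      ∑ t, ((∑ j, θ j * ut t j) - ∑ j, θt t j * ut t j) =
        (∑ j, θ j * ∑ t, ut t j) - ∑ t, ∑ j, θt t j * ut t j := fun θ => by
    rw [Finset.sum_sub_distrib, hswap]
  have hsum : ∑ t, ∑ j, θt t j * ut t j ≤ 0 := Finset.sum_nonpos fun t _ => hsep t
  have hbdd : BddAbove ((fun θ => ∑ t, ((∑ j, θ j * ut t j) - ∑ j, θt t j * ut t j)) ''
      {θ : Fin N → ℝ | ∀ x : Fin N → ℝ,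
        (∑ j, θ j * x j) ≤
          max (Finset.univ.sup' ⟨⟨0, hd⟩, Finset.mem_univ _⟩
            (fun i => ∑ j, v i j * x j)) 0}) := by
    refine ⟨max (Finset.univ.sup' ⟨⟨0, hd⟩, Finset.mem_univ _⟩
      (fun i => ∑ j, v i j * ∑ t, ut t j)) 0 - ∑ t, ∑ j, θt t j * ut t j, ?_⟩
    rintro _ ⟨θ, hθmem, rfl⟩
    simp only [hregret]
    exact sub_le_sub_right (hθmem fun j => ∑ t, ut t j) _
  have hdist : sInf ((fun c =>
      max (Finset.univ.sup' ⟨⟨0, hd⟩, Finset.mem_univ _⟩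
        (fun i => ∑ j, v i j * ((1 / (T : ℝ)) * (∑ t, ut t j) - c j))) 0) ''
      {x : Fin N → ℝ | ∀ i, (∑ j, v i j * x j) ≤ 0}) ≤
      max (Finset.univ.sup' ⟨⟨0, hd⟩, Finset.mem_univ _⟩
        (fun i => ∑ j, v i j * ((1 / (T : ℝ)) * (∑ t, ut t j)))) 0 := by
    refine csInf_le ⟨0, ?_⟩ ⟨0, by simp, by simp⟩
    rintro _ ⟨c, -, rfl⟩
    exact le_max_right _ _
  refine (mul_le_mul_of_nonneg_left hdist hT'.le).trans ?_
  rw [mul_max_of_nonneg _ _ hT'.le, mul_zero]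
  refine max_le ?_ ?_
  · obtain ⟨i, -, hi⟩ := Finset.exists_mem_eq_sup' (s := (Finset.univ : Finset (Fin d)))
      ⟨⟨0, hd⟩, Finset.mem_univ _⟩
      (fun i => ∑ j, v i j * ((1 / (T : ℝ)) * (∑ t, ut t j)))
    rw [hi]
    refine le_trans ?_ (le_csSup hbdd ⟨v i, fun x => ?_, rfl⟩)
    · have hscale : (T : ℝ) * ∑ j, v i j * ((1 / (T : ℝ)) * ∑ t, ut t j) =
          ∑ j, v i j * ∑ t, ut t j := by
        rw [Finset.mul_sum]
        refine Finset.sum_congr rfl fun j _ => ?_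
        field_simp
      simp only [hregret, hscale]
      linarith
    · exact le_max_of_le_left
        (Finset.le_sup' (fun i => ∑ j, v i j * x j) (Finset.mem_univ i))
  · refine le_trans ?_ (le_csSup hbdd ⟨0, fun x => by simp, rfl⟩)
    beta_reduce
    rw [hregret]
    simpa only [Pi.zero_apply, zero_mul, Finset.sum_const_zero, zero_sub,
      Left.nonneg_neg_iff] using hsum
end

section
/- Let f : ℝ^N → ℝ be a pseudonorm with dual set T*_f (which is compact and contains 0), let Z ⊆ ℝ^N be a convex cone, and let T*_f(Z) = {θ : ∀ z ∈ Z, ⟨θ, z⟩ ≤ f(z)}. Fix z ∈ Z, η > 0, and let R(θ) = ‖θ‖². If θ_opt minimizes the function θ ↦ η·R(θ) − ⟨θ, z⟩ over T*_f(Z), then ‖θ_opt‖ ≤ diam(T*_f). -/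
/-- **Sandwich theorem.** A linear functional dominated by a sublinear function on a convex cone
is dominated on this cone by a linear functional lying below the sublinear function everywhere. -/
theorem exists_linearMap_le_sublinear_and_ge_on_cone {E : Type*} [AddCommGroup E] [Module ℝ E]
    (f : E → ℝ) (hf_homog : ∀ α : ℝ, 0 ≤ α → ∀ x, f (α • x) = α * f x)
    (hf_tri : ∀ x y, f (x + y) ≤ f x + f y) (Z : Set E) (hZ_zero : (0 : E) ∈ Z)
    (hZ_add : ∀ x ∈ Z, ∀ y ∈ Z, x + y ∈ Z) (hZ_smul : ∀ x ∈ Z, ∀ α : ℝ, 0 ≤ α → α • x ∈ Z)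
    (l : E →ₗ[ℝ] ℝ) (hl : ∀ w ∈ Z, l w ≤ f w) :
    ∃ g : E →ₗ[ℝ] ℝ, (∀ x, g x ≤ f x) ∧ ∀ w ∈ Z, l w ≤ g w := by
  have hf_zero : f 0 = 0 := by simpa using hf_homog 0 le_rfl 0
  have : Nonempty Z := ⟨⟨0, hZ_zero⟩⟩
  set p : E → ℝ := fun x ↦ ⨅ w : Z, (f (x + w) - l w) with hp
  have hbdd (x : E) : BddBelow (Set.range fun w : Z ↦ f (x + w) - l w) := by
    refine ⟨-f (-x), ?_⟩
    rintro _ ⟨w, rfl⟩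
    have h₁ := hf_tri (-x) (x + w)
    have h₂ := hl w w.2
    rw [neg_add_cancel_left] at h₁
    dsimp only
    linarith
  have hp_le (x w : E) (hw : w ∈ Z) : p x ≤ f (x + w) - l w := ciInf_le (hbdd x) ⟨w, hw⟩
  have hp_smul_le (c : ℝ) (hc : 0 < c) (x : E) : p (c • x) ≤ c * p x := by
    rw [hp, Real.mul_iInf_of_nonneg hc.le]
    refine le_ciInf fun w ↦ (hp_le (c • x) (c • w) (hZ_smul w w.2 c hc.le)).trans_eq ?_
    rw [← smul_add, hf_homog c hc.le, map_smul, smul_eq_mul, mul_sub]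
  have hp_smul (c : ℝ) (hc : 0 < c) (x : E) : p (c • x) = c * p x := by
    refine (hp_smul_le c hc x).antisymm ?_
    have h := mul_le_mul_of_nonneg_left (hp_smul_le c⁻¹ (inv_pos.2 hc) (c • x)) hc.le
    rwa [inv_smul_smul₀ hc.ne', mul_inv_cancel_left₀ hc.ne'] at h
  have hp_add (x y : E) : p (x + y) ≤ p x + p y := by
    refine le_ciInf_add_ciInf fun v w ↦ ?_
    have h₁ := hp_le (x + y) (v + w) (hZ_add v v.2 w w.2)
    have h₂ := hf_tri (x + v) (y + w)
    rw [add_add_add_comm, map_add] at h₁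
    linarith
  obtain ⟨g, -, hg⟩ := exists_extension_of_le_sublinear (⊥ : E →ₗ.[ℝ] ℝ) p hp_smul hp_add (by
    rintro ⟨x, hx⟩
    obtain rfl : x = 0 := (Submodule.mem_bot ℝ).1 hx
    have h : 0 ≤ p 0 := le_ciInf fun w ↦ by simpa using hl w w.2
    exact (LinearPMap.map_zero _).trans_le h)
  refine ⟨g, fun x ↦ ?_, fun w hw ↦ ?_⟩
  · simpa using (hg x).trans (hp_le x 0 hZ_zero)
  · have h := (hg (-w)).trans (hp_le (-w) w hw)
    rw [neg_add_cancel, hf_zero, map_neg] at h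
    linarith

/-- At a minimizer of `η ‖θ‖² - ⟪z, θ⟫` over a convex set, the directional derivative towards any
point of the set is nonnegative. -/
theorem inner_sub_le_of_forall_quadratic_le {E : Type*} [NormedAddCommGroup E]
    [InnerProductSpace ℝ E] {S : Set E} (hS : Convex ℝ S) {z θ t : E} {η : ℝ}
    (hθ : θ ∈ S) (ht : t ∈ S)
    (hmin : ∀ s ∈ S, η * ‖θ‖ ^ 2 - inner ℝ z θ ≤ η * ‖s‖ ^ 2 - inner ℝ z s) :
    inner ℝ z (t - θ) ≤ 2 * η * inner ℝ θ (t - θ) := by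
  have key (ε : ℝ) (hε : ε ∈ Set.Ioc (0 : ℝ) 1) :
      inner ℝ z (t - θ) ≤ 2 * η * inner ℝ θ (t - θ) + ε * (η * ‖t - θ‖ ^ 2) := by
    have h := hmin _ (hS.add_smul_sub_mem hθ ht ⟨hε.1.le, hε.2⟩)
    rw [norm_add_sq_real, inner_add_right, inner_smul_right, inner_smul_right, norm_smul,
      Real.norm_of_nonneg hε.1.le] at h
    refine le_of_mul_le_mul_left ?_ hε.1
    linarith
  have hlim : Filter.Tendsto
      (fun ε : ℝ ↦ 2 * η * inner ℝ θ (t - θ) + ε * (η * ‖t - θ‖ ^ 2))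
      (nhdsWithin 0 (Set.Ioi 0)) (nhds (2 * η * inner ℝ θ (t - θ))) := by
    refine Filter.Tendsto.mono_left ?_ nhdsWithin_le_nhds
    have hcont : Continuous
        (fun ε : ℝ ↦ 2 * η * inner ℝ θ (t - θ) + ε * (η * ‖t - θ‖ ^ 2)) := by fun_prop
    simpa using hcont.tendsto 0
  exact ge_of_tendsto hlim (Filter.eventually_of_mem (Ioc_mem_nhdsGT one_pos) key)


/-- **Quadratic-regularized optimization over the extended dual set stays bounded.**
Let `f` be a pseudonorm on Euclidean `ℝ^N` whose dual set
`T*_f = {θ | ∀ x, ⟨θ,x⟩ ≤ f x}` is compact and contains `0`, let `Z` be a convex cone,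
`T*_f(Z) = {θ | ∀ z ∈ Z, ⟨θ,z⟩ ≤ f z}`, `z ∈ Z`, `η > 0`, and `R θ = ‖θ‖²`.
If `θ_opt` minimizes `θ ↦ η R θ − ⟨θ, z⟩` over `T*_f(Z)`, then
`‖θ_opt‖ ≤ diam (T*_f)`. -/
theorem quadratic_ftrl_extended_dual_bounded (N : ℕ)
    (f : EuclideanSpace ℝ (Fin N) → ℝ)
    (hf_nonneg : ∀ z, 0 ≤ f z) (hf_zero : f 0 = 0)
    (hf_homog : ∀ (α : ℝ), 0 ≤ α → ∀ z, f (α • z) = α * f z)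
    (hf_tri : ∀ z z', f (z + z') ≤ f z + f z')
    (hT_cpt : IsCompact {θ : EuclideanSpace ℝ (Fin N) | ∀ x, (∑ i, θ i * x i) ≤ f x})
    (hT_zero : (0 : EuclideanSpace ℝ (Fin N)) ∈
      {θ : EuclideanSpace ℝ (Fin N) | ∀ x, (∑ i, θ i * x i) ≤ f x})
    (Z : Set (EuclideanSpace ℝ (Fin N))) (hZ_conv : Convex ℝ Z)
    (hZ_cone : ∀ x ∈ Z, ∀ α : ℝ, 0 ≤ α → α • x ∈ Z)
    (z : EuclideanSpace ℝ (Fin N)) (hz : z ∈ Z)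
    (η : ℝ) (hη : 0 < η)
    (θopt : EuclideanSpace ℝ (Fin N))
    (hopt_mem : θopt ∈ {θ : EuclideanSpace ℝ (Fin N) | ∀ w ∈ Z, (∑ i, θ i * w i) ≤ f w})
    (hopt_min : ∀ θ ∈ {θ : EuclideanSpace ℝ (Fin N) | ∀ w ∈ Z, (∑ i, θ i * w i) ≤ f w},
        η * ‖θopt‖ ^ 2 - (∑ i, θopt i * z i) ≤ η * ‖θ‖ ^ 2 - (∑ i, θ i * z i)) :
    ‖θopt‖ ≤ Metric.diam {θ : EuclideanSpace ℝ (Fin N) | ∀ x, (∑ i, θ i * x i) ≤ f x} := by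
  have hinner (θ x : EuclideanSpace ℝ (Fin N)) : ∑ i, θ i * x i = inner ℝ x θ := by
    simp [PiLp.inner_apply]
  simp only [hinner, Set.mem_ofPred_eq] at hT_cpt hT_zero hopt_mem hopt_min ⊢
  have hZ_add : ∀ x ∈ Z, ∀ y ∈ Z, x + y ∈ Z := fun x hx y hy ↦ by
    have h := hZ_cone _ (hZ_conv hx hy (by norm_num : (0 : ℝ) ≤ 1 / 2)
      (by norm_num : (0 : ℝ) ≤ 1 / 2) (by norm_num))
      2 zero_le_two
    rwa [← smul_add, smul_smul, mul_one_div_cancel two_ne_zero, one_smul] at h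
  obtain ⟨g, hgf, hgZ⟩ := exists_linearMap_le_sublinear_and_ge_on_cone f hf_homog hf_tri Z
    (by simpa using hZ_cone z hz 0 le_rfl) hZ_add hZ_cone
    (innerSL ℝ θopt : EuclideanSpace ℝ (Fin N) →ₗ[ℝ] ℝ)
    (fun w hw ↦ by simpa [real_inner_comm] using hopt_mem w hw)
  set t := (InnerProductSpace.toDual ℝ (EuclideanSpace ℝ (Fin N))).symm
    (LinearMap.toContinuousLinearMap g) with ht_def
  have htg (x : EuclideanSpace ℝ (Fin N)) : inner ℝ x t = g x := by
    rw [real_inner_comm, ht_def, InnerProductSpace.toDual_symm_apply]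
    rfl
  have htf (x : EuclideanSpace ℝ (Fin N)) : inner ℝ x t ≤ f x := (htg x).trans_le (hgf x)
  have htz : 0 ≤ inner ℝ z (t - θopt) := by
    rw [inner_sub_right, htg, sub_nonneg]
    simpa [real_inner_comm] using hgZ z hz
  have hS : Convex ℝ {θ : EuclideanSpace ℝ (Fin N) | ∀ w ∈ Z, inner ℝ w θ ≤ f w} := by
    intro x hx y hy a b ha hb hab w hw
    rw [inner_add_right, inner_smul_right, inner_smul_right]
    calc a * inner ℝ w x + b * inner ℝ w y ≤ a * f w + b * f w := by
          gcongr
          exacts [hx w hw, hy w hw]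
      _ = f w := by rw [← add_mul, hab, one_mul]
  have hderiv : 0 ≤ inner ℝ θopt (t - θopt) :=
    nonneg_of_mul_nonneg_right (htz.trans
      (inner_sub_le_of_forall_quadratic_le hS hopt_mem (fun w _ ↦ htf w) hopt_min))
      (by positivity)
  have hnorm : ‖θopt‖ ≤ ‖t‖ := by
    rw [inner_sub_right, real_inner_self_eq_norm_sq, sub_nonneg] at hderiv
    have h := hderiv.trans (real_inner_le_norm θopt t)
    nlinarith [norm_nonneg θopt, norm_nonneg t]
  calc ‖θopt‖ ≤ dist t 0 := by rwa [dist_zero_right]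
    _ ≤ _ := Metric.dist_le_diam_of_mem hT_cpt.isBounded htf hT_zero
end
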